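/- Let P be an n×n quaternionic matrix that is a Hermitian idempotent (Pᴴ = P and P² = P). Then re(tr(P)) is a natural number q with 0 ≤ q ≤ n; i.e., there exists q ∈ ℕ with q ≤ n and re(tr(P)) = q. -/

import Mathlib

open scoped Quaternion Matrix

/-- Rank factorization of an idempotent matrix over a division ring. -/
theorem Matrix.exists_rank_factorization_of_isIdempotentElem {D m : Type*} [DivisionRing D]
    [Fintype m] [DecidableEq m] {P : Matrix m m D} (hP : IsIdempotentElem P) :
    ∃ q ≤ Fintype.card m, ∃ (A : Matrix m (Fin q) D) (B : Matrix (Fin q) m D),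
      A * B = P ∧ B * A = 1 := by
  let f : (m → D) →ₗ[D] (m → D) := P.vecMulLinear
  let g := f.rangeRestrict
  let b := Module.finBasis D f.range
  have hg (y : f.range) : g y = y := by
    obtain ⟨_, x, rfl⟩ := y
    ext1
    change (x ᵥ* P) ᵥ* P = x ᵥ* P
    rw [Matrix.vecMul_vecMul, hP.eq]
  refine ⟨Module.finrank D f.range, ?_, .of fun j k ↦ b.repr (g (Pi.single j 1)) k,
    .of fun i j ↦ (b i : m → D) j, ?_, ?_⟩
  · simpa using Submodule.finrank_le f.range
  · ext j l
    have h := congrArg (fun y : f.range ↦ (y : m → D) l) (b.sum_repr (g (Pi.single j 1)))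
    have hgj : (g (Pi.single j 1) : m → D) l = P j l := by
      change (Pi.single j 1 ᵥ* P) l = P j l
      simp
    simpa [Matrix.mul_apply, hgj, -Module.Basis.sum_repr] using h
  · ext i k
    have h : g (∑ j, (b i : m → D) j • Pi.single j 1) = b i := by
      rw [← pi_eq_sum_univ' (b i : m → D)]
      exact hg (b i)
    have h' := congrArg (fun y ↦ b.repr y k) h
    simpa [Matrix.mul_apply, Matrix.one_apply, Finsupp.single_apply] using h'

theorem Quaternion.re_mul_comm {R : Type*} [CommRing R] (a b : ℍ[R]) :
    (a * b).re = (b * a).re := by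
  simp only [Quaternion.re_mul]
  ring

theorem Quaternion.re_finset_sum {R ι : Type*} [CommRing R] (s : Finset ι) (f : ι → ℍ[R]) :
    (∑ i ∈ s, f i).re = ∑ i ∈ s, (f i).re :=
  map_sum (AddMonoidHom.mk' (fun a : ℍ[R] ↦ a.re) Quaternion.re_add) f s

theorem Matrix.re_trace_mul_comm {R m n : Type*} [CommRing R] [Fintype m] [Fintype n]
    (A : Matrix m n ℍ[R]) (B : Matrix n m ℍ[R]) :
    (A * B).trace.re = (B * A).trace.re := by
  simp only [Matrix.trace, Matrix.diag, Matrix.mul_apply, Quaternion.re_finset_sum]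
  rw [Finset.sum_comm]
  simp only [Quaternion.re_mul_comm (A _ _)]

theorem re_trace_hermitian_idempotent (n : ℕ) (P : Matrix (Fin n) (Fin n) ℍ[ℝ])
    (hherm : Pᴴ = P) (hidem : P * P = P) :
    ∃ q : ℕ, q ≤ n ∧ (P.trace).re = (q : ℝ) := by
  obtain ⟨q, hq, A, B, rfl, hBA⟩ := Matrix.exists_rank_factorization_of_isIdempotentElem hidem
  refine ⟨q, by simpa using hq, ?_⟩
  rw [Matrix.re_trace_mul_comm, hBA]
  simp
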